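/- arXiv:1103.1201 — 2 statements merged into one kernel-verified Lean document; each statement's English description precedes it below -/
import Mathlib

section
/- Let 𝔤 be a compact semisimple Lie algebra, ω_𝔤 its Cartan 3-form, and for τ ∈ Λ²(𝔤) ≅ 𝔰𝔬(𝔤) let ρ_*(τ) denote the induced action of the skew-symmetric endomorphism corresponding to τ on Λ³(𝔤). Then ρ_*(τ)(ω_𝔤) = d_𝔤 τ, where d_𝔤 : Λ²(𝔤) → Λ³(𝔤) is the Chevalley–Eilenberg differential. -/
open scoped InnerProductSpace

noncomputable section

variable {g : Type*} [NormedAddCommGroup g] [InnerProductSpace ℝ g]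

/-- `Λ^k(𝔤)`, realized as alternating `k`-forms via the metric identification. -/
abbrev Form (g : Type*) [NormedAddCommGroup g] [InnerProductSpace ℝ g] (k : ℕ) : Type _ :=
  g [⋀^Fin k]→ₗ[ℝ] ℝ

/-- The wedge product of alternating forms (shuffle-sum convention). -/
def wedgeF {p q : ℕ} (α : Form g p) (β : Form g q) : Form g (p + q) :=
  AlternatingMap.domDomCongr finSumFinEquiv
    ((TensorProduct.lid ℝ ℝ).toLinearMap.compAlternatingMap (α.domCoprod β))

/-- Contraction (interior product) of a form with a vector. -/
def ctr {k : ℕ} (v : g) (φ : Form g (k + 1)) : Form g k := φ.curryLeft v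

/-- The metric identification of a vector with a 1-form. -/
def flat (v : g) : Form g 1 :=
  AlternatingMap.ofSubsingleton ℝ g ℝ (0 : Fin 1) ((innerSL ℝ v).toLinearMap)

/-- Degree cast. -/
def castF {a b : ℕ} (h : a = b) (φ : Form g a) : Form g b :=
  AlternatingMap.domDomCongr (finCongr h) φ

/-- Inner product on `k`-forms induced by an orthonormal basis. -/
def innerF {ι : Type*} [Fintype ι] (e : OrthonormalBasis ι ℝ g) (k : ℕ)
    (α β : Form g k) : ℝ :=
  (Nat.factorial k : ℝ)⁻¹ * ∑ f : Fin k → ι, α (fun i => e (f i)) * β (fun i => e (f i))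

/-- The decomposable form `v_1♭ ∧ ⋯ ∧ v_k♭` associated with a `k`-tuple of vectors. -/
def wedgeFam : ∀ {k : ℕ}, (Fin k → g) → Form g k
  | 0, _ => AlternatingMap.constOfIsEmpty ℝ g (Fin 0) 1
  | (k + 1), v => castF (by omega) (wedgeF (flat (v 0)) (wedgeFam (fun i => v i.succ)))

/-- The skew-symmetric endomorphism `x ↦ ⟪v,x⟫w − ⟪w,x⟫v` corresponding to the
2-vector `v ∧ w`. -/
def hat (v w : g) : g →ₗ[ℝ] g :=
  ((innerSL ℝ v).toLinearMap).smulRight w - ((innerSL ℝ w).toLinearMap).smulRight v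


open Equiv in
theorem sum_perm3 (f : Perm (Fin 3) → ℝ) : ∑ σ, f σ =
   f 1 + f (swap 0 1) + f (swap 0 2) + f (swap 1 2) + f (swap 0 1 * swap 1 2) + f (swap 1 2 * swap 0 1) := by
  have : (Finset.univ : Finset (Perm (Fin 3))) = {1, swap 0 1, swap 0 2, swap 1 2, swap 0 1 * swap 1 2, swap 1 2 * swap 0 1} := by decide
  rw [this]
  repeat rw [Finset.sum_insert (by decide)]
  rw [Finset.sum_singleton]; ring

open Equiv in
theorem sum_perm2 (f : Perm (Fin 2) → ℝ) : ∑ σ, f σ = f 1 + f (swap 0 1) := by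
  have : (Finset.univ : Finset (Perm (Fin 2))) = {1, swap 0 1} := by decide
  rw [this]
  repeat rw [Finset.sum_insert (by decide)]
  rw [Finset.sum_singleton]

theorem wedgeF_apply_fac {p q : ℕ} (α : Form g p) (β : Form g q) (v : Fin (p+q) → g) :
    ((p.factorial * q.factorial : ℕ) : ℝ) * wedgeF α β v =
    ∑ σ : Equiv.Perm (Fin (p+q)), ((Equiv.Perm.sign σ : ℤ) : ℝ) *
      (α (fun i => v (σ (Fin.castAdd q i))) * β (fun j => v (σ (Fin.natAdd p j)))) := by
  have h := MultilinearMap.domCoprod_alternization_eq α β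
  have h2 := congrArg (fun φ => (TensorProduct.lid ℝ ℝ) (φ (v ∘ finSumFinEquiv))) h
  simp only [MultilinearMap.alternatization_apply, AlternatingMap.smul_apply, map_nsmul, map_sum, Fintype.card_fin] at h2
  rw [← nsmul_eq_mul]
  refine Eq.trans h2.symm ?_
  rw [← (finSumFinEquiv (m := p) (n := q)).permCongr.sum_comp]
  refine Finset.sum_congr rfl fun σ _ => ?_
  rw [Units.smul_def, map_zsmul, zsmul_eq_mul]
  simp [Function.comp_def]

theorem vec1 (f : Fin 1 → g) : f = ![f 0] := by
  ext i; fin_cases i; rfl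

theorem vec2 (f : Fin 2 → g) : f = ![f 0, f 1] := by
  ext i; fin_cases i <;> rfl

theorem form2_swap (α : Form g 2) (x y : g) : α ![y, x] = - α ![x, y] := by
  have h := α.map_swap ![x, y] (show (0 : Fin 2) ≠ 1 by decide)
  rw [← h]; congr 1; ext i; fin_cases i <;> rfl

theorem wedge11 (α β : Form g 1) (x y : g) :
    wedgeF α β ![x, y] = α ![x] * β ![y] - α ![y] * β ![x] := by
  have h := wedgeF_apply_fac α β ![x, y]
  have h' : ∀ σ : Equiv.Perm (Fin (1+1)), ((Equiv.Perm.sign σ : ℤ) : ℝ) *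
      (α (fun i => ![x, y] (σ (Fin.castAdd 1 i))) * β (fun j => ![x, y] (σ (Fin.natAdd 1 j)))) =
      ((Equiv.Perm.sign σ : ℤ) : ℝ) * (α ![![x, y] (σ 0)] * β ![![x, y] (σ 1)]) := by
    intro σ
    rw [vec1 (fun i => ![x, y] (σ (Fin.castAdd 1 i))), vec1 (fun j => ![x, y] (σ (Fin.natAdd 1 j)))]
    rfl
  rw [Finset.sum_congr rfl (fun σ _ => h' σ)] at h
  erw [sum_perm2] at h
  simp at h
  rw [h]; ring

theorem wedge21 (α : Form g 2) (β : Form g 1) (x y z : g) :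
    wedgeF α β ![x, y, z] = α ![x, y] * β ![z] - α ![x, z] * β ![y] + α ![y, z] * β ![x] := by
  have h := wedgeF_apply_fac α β ![x, y, z]
  have h' : ∀ σ : Equiv.Perm (Fin (2+1)), ((Equiv.Perm.sign σ : ℤ) : ℝ) *
      (α (fun i => ![x, y, z] (σ (Fin.castAdd 1 i))) * β (fun j => ![x, y, z] (σ (Fin.natAdd 2 j)))) =
      ((Equiv.Perm.sign σ : ℤ) : ℝ) *
        (α ![![x, y, z] (σ 0), ![x, y, z] (σ 1)] * β ![![x, y, z] (σ 2)]) := by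
    intro σ
    rw [vec2 (fun i => ![x, y, z] (σ (Fin.castAdd 1 i))),
      vec1 (fun j => ![x, y, z] (σ (Fin.natAdd 2 j)))]
    rfl
  rw [Finset.sum_congr rfl (fun σ _ => h' σ)] at h
  erw [sum_perm3] at h
  simp [Equiv.swap_apply_def, form2_swap α x y, form2_swap α x z, form2_swap α y z] at h
  linarith

theorem wedge12 (α : Form g 1) (β : Form g 2) (x y z : g) :
    castF rfl (wedgeF α β) ![x, y, z] = α ![x] * β ![y, z] - α ![y] * β ![x, z] + α ![z] * β ![x, y] := by
  have h := wedgeF_apply_fac α β ![x, y, z]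
  have h' : ∀ σ : Equiv.Perm (Fin (1+2)), ((Equiv.Perm.sign σ : ℤ) : ℝ) *
      (α (fun i => ![x, y, z] (σ (Fin.castAdd 2 i))) * β (fun j => ![x, y, z] (σ (Fin.natAdd 1 j)))) =
      ((Equiv.Perm.sign σ : ℤ) : ℝ) *
        (α ![![x, y, z] (σ 0)] * β ![![x, y, z] (σ 1), ![x, y, z] (σ 2)]) := by
    intro σ
    rw [vec1 (fun i => ![x, y, z] (σ (Fin.castAdd 2 i))),
      vec2 (fun j => ![x, y, z] (σ (Fin.natAdd 1 j)))]
    rfl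
  rw [Finset.sum_congr rfl (fun σ _ => h' σ)] at h
  erw [sum_perm3] at h
  simp [Equiv.swap_apply_def, form2_swap β x y, form2_swap β x z, form2_swap β y z] at h
  change wedgeF α β ![x, y, z] = _
  linarith

theorem form_sum_apply {ι : Type*} {k : ℕ} (s : Finset ι) (f : ι → Form g k) (v : Fin k → g) :
    (∑ i ∈ s, f i) v = ∑ i ∈ s, f i v := by
  classical
  induction s using Finset.induction_on with
  | empty => simp
  | insert a s ha ih => rw [Finset.sum_insert ha, Finset.sum_insert ha, AlternatingMap.add_apply, ih]

theorem flat_app (v x : g) : flat v ![x] = ⟪v, x⟫_ℝ := by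
  simp [flat]

theorem decomp2 {ι : Type*} [Fintype ι] (e : OrthonormalBasis ι ℝ g) (τ : Form g 2) :
    τ = (2⁻¹ : ℝ) • ∑ i, (wedgeF (flat (e i)) (flat (∑ j, τ ![e i, e j] • e j)) : Form g 2) := by
  have h1 : ∀ u v : g, τ ![u, v] = ∑ j, ⟪e j, v⟫_ℝ * τ ![u, e j] := by
    intro u v
    conv_lhs => rw [← e.sum_repr' v]
    have h := τ.toMultilinearMap.map_update_sum Finset.univ 1 (fun j => ⟪e j, v⟫_ℝ • e j) ![u, v]
    have hu : ∀ b : g, Function.update ![u, v] 1 b = ![u, b] := by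
      intro b; ext i; fin_cases i <;> rfl
    have hsm : ∀ (c : ℝ) (b : g), τ ![u, c • b] = c * τ ![u, b] := by
      intro c b
      rw [← hu (c • b), ← hu b, τ.map_update_smul, smul_eq_mul]
    simp only [hu] at h
    refine h.trans (Finset.sum_congr rfl fun j _ => hsm _ _)
  have h2 : ∀ u v : g, τ ![u, v] = ∑ j, ⟪e j, u⟫_ℝ * τ ![e j, v] := by
    intro u v
    rw [form2_swap, h1, ← Finset.sum_neg_distrib]
    refine Finset.sum_congr rfl fun j _ => ?_
    rw [form2_swap τ (e j) v]; ring
  have h3 : ∀ i v, ⟪∑ j, τ ![e i, e j] • e j, v⟫_ℝ = τ ![e i, v] := by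
    intro i v
    rw [h1 (e i) v, sum_inner]
    refine Finset.sum_congr rfl fun j _ => ?_
    rw [real_inner_smul_left]; ring
  ext w
  rw [vec2 w]
  generalize w 0 = x
  generalize w 1 = y
  rw [AlternatingMap.smul_apply, form_sum_apply]
  have : ∀ i, (wedgeF (flat (e i)) (flat (∑ j, τ ![e i, e j] • e j)) : Form g 2) ![x, y]
     = ⟪e i, x⟫_ℝ * τ ![e i, y] - ⟪e i, y⟫_ℝ * τ ![e i, x] := by
    intro i
    rw [wedge11, flat_app, flat_app, flat_app, flat_app, h3, h3]
  rw [Finset.sum_congr rfl (fun i _ => this i), Finset.sum_sub_distrib, ← h2, ← h2, form2_swap τ x y, smul_eq_mul]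
  ring

theorem decomp2' {ι : Type*} [Fintype ι] (e : OrthonormalBasis ι ℝ g) (τ : Form g 2) :
    ∃ B : ι → g, τ = (2⁻¹ : ℝ) • ∑ i, (wedgeF (flat (e i)) (flat (B i)) : Form g 2) :=
  ⟨_, decomp2 e τ⟩

theorem core_identity {ι : Type*} [Fintype ι] (e : OrthonormalBasis ι ℝ g) (br : g → g → g)
    (ω : Form g 3) (D : ∀ k, Form g k →ₗ[ℝ] Form g (k + 1))
    (hD1 : ∀ v x y : g, D 1 (flat v) ![x, y] = ⟪v, br x y⟫_ℝ)
    (hDanti : ∀ (p q : ℕ) (α : Form g p) (β : Form g q)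
      (h1 : p + 1 + q = p + q + 1) (h2 : p + (q + 1) = p + q + 1),
      D (p + q) (wedgeF α β) =
        castF h1 (wedgeF (D p α) β) +
          ((-1 : ℝ) ^ p) • castF h2 (wedgeF α (D q β)))
    (τ : Form g 2) (x y z : g) (Aτ : g → g)
    (hA : ∀ u b c : g, ω ![Aτ u, b, c] = ∑ i, τ ![u, e i] * ⟪e i, br b c⟫_ℝ) :
    -(ω ![Aτ x, y, z] + ω ![x, Aτ y, z] + ω ![x, y, Aτ z]) = D 2 τ ![x, y, z] := by
  have cyc1 : ∀ a b c : g, ω ![a, b, c] = ω ![b, c, a] := by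
    intro a b c
    have h := ω.map_swap ![a, b, c] (show (0 : Fin 3) ≠ 1 by decide)
    have h' := ω.map_swap (![a, b, c] ∘ Equiv.swap 0 1) (show (1 : Fin 3) ≠ 2 by decide)
    rw [h, neg_neg] at h'
    rw [← h']; congr 1; ext i; fin_cases i <;> rfl
  rw [cyc1 x _ z, ← cyc1 _ x y, hA, hA, hA]
  -- the identity is linear in the 2-form
  have key : ∀ v w : g, D 2 (wedgeF (flat v) (flat w) : Form g 2) ![x, y, z] =
      -(∑ i, (wedgeF (flat v) (flat w) : Form g 2) ![x, e i] * ⟪e i, br y z⟫_ℝ +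
        ∑ i, (wedgeF (flat v) (flat w) : Form g 2) ![y, e i] * ⟪e i, br z x⟫_ℝ +
        ∑ i, (wedgeF (flat v) (flat w) : Form g 2) ![z, e i] * ⟪e i, br x y⟫_ℝ) := by
    intro v w
    have hs : ∀ u b : g, ∑ i, (wedgeF (flat v) (flat w) : Form g 2) ![u, e i] * ⟪e i, b⟫_ℝ =
        ⟪v, u⟫_ℝ * ⟪w, b⟫_ℝ - ⟪w, u⟫_ℝ * ⟪v, b⟫_ℝ := by
      intro u b
      rw [← e.sum_inner_mul_inner w b, ← e.sum_inner_mul_inner v b, Finset.mul_sum,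
        Finset.mul_sum, ← Finset.sum_sub_distrib]
      refine Finset.sum_congr rfl fun i _ => ?_
      rw [wedge11, flat_app, flat_app, flat_app, flat_app]; ring
    rw [hs, hs, hs]
    have h := congrArg (fun φ : Form g 3 => φ ![x, y, z]) (hDanti 1 1 (flat v) (flat w) rfl rfl)
    have e1 : (castF rfl (wedgeF (D 1 (flat v)) (flat w)) : Form g 3) ![x, y, z] =
      wedgeF (D 1 (flat v)) (flat w) ![x, y, z] := rfl
    have h2 : D 2 (wedgeF (flat v) (flat w) : Form g 2) ![x, y, z] =
        wedgeF (D 1 (flat v)) (flat w) ![x, y, z] +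
        ((-1 : ℝ) ^ 1) * (castF rfl (wedgeF (flat v) (D 1 (flat w))) : Form g 3) ![x, y, z] := h
    rw [h2, wedge21, wedge12]
    have hsk : ∀ u : g, ⟪u, br z x⟫_ℝ = - ⟪u, br x z⟫_ℝ := by
      intro u
      rw [← hD1, ← hD1, form2_swap]
    simp only [flat_app, hD1, hsk]
    ring
  obtain ⟨B, hd⟩ := decomp2' e τ
  have hsum : ∀ u b : g, ∑ i, τ ![u, e i] * ⟪e i, b⟫_ℝ =
      2⁻¹ * ∑ k, ∑ i, (wedgeF (flat (e k)) (flat (B k)) : Form g 2) ![u, e i] * ⟪e i, b⟫_ℝ := by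
    intro u b
    rw [Finset.sum_comm, Finset.mul_sum]
    refine Finset.sum_congr rfl fun i _ => ?_
    conv_lhs => rw [hd, AlternatingMap.smul_apply, form_sum_apply, smul_eq_mul]
    rw [mul_assoc, Finset.sum_mul]
  have hDs : D 2 τ ![x, y, z] =
      2⁻¹ * ∑ k, D 2 (wedgeF (flat (e k)) (flat (B k)) : Form g 2) ![x, y, z] := by
    conv_lhs => rw [hd, map_smul, map_sum, AlternatingMap.smul_apply, form_sum_apply, smul_eq_mul]
  rw [hDs, hsum, hsum, hsum, Finset.sum_congr rfl (fun k _ => key (e k) (B k)),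
    Finset.sum_neg_distrib, Finset.sum_add_distrib, Finset.sum_add_distrib]
  ring

/-- Let `𝔤` be a compact semisimple Lie algebra, `ω_𝔤` its Cartan
3-form, and for `τ ∈ Λ²(𝔤) ≅ 𝔰𝔬(𝔤)` let `ρ_*(τ)` denote the induced action of the
corresponding skew-symmetric endomorphism `A_τ x = Σ_i τ(x,e_i) e_i` on 3-forms
(the metric transport of the derivation action on `Λ³(𝔤)`).  Then
`ρ_*(τ)(ω_𝔤) = d_𝔤 τ`, where `d_𝔤 : Λ²(𝔤) → Λ³(𝔤)` is the Chevalley–Eilenberg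
differential. -/
theorem rho_star_cartan_form_eq_differential
    {g : Type*} [NormedAddCommGroup g] [InnerProductSpace ℝ g] [FiniteDimensional ℝ g]
    [LieRing g] [LieAlgebra ℝ g]
    (hK : ∀ x y : g, ⟪x, y⟫_ℝ = - killingForm ℝ g x y)
    {ι : Type*} [Fintype ι] (e : OrthonormalBasis ι ℝ g)
    (ω : Form g 3) (hω : ∀ x y z : g, ω ![x, y, z] = ⟪x, ⁅y, z⁆⟫_ℝ)
    (D : ∀ k, Form g k →ₗ[ℝ] Form g (k + 1))
    (hD0 : ∀ φ : Form g 0, D 0 φ = 0)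
    (hD1 : ∀ v x y : g, D 1 (flat v) ![x, y] = ⟪v, ⁅x, y⁆⟫_ℝ)
    (hDanti : ∀ (p q : ℕ) (α : Form g p) (β : Form g q),
      D (p + q) (wedgeF α β) =
        castF (by omega) (wedgeF (D p α) β) +
          ((-1 : ℝ) ^ p) • castF (by omega) (wedgeF α (D q β))) :
    ∀ (τ : Form g 2) (x y z : g),
      let Aτ : g → g := fun u => ∑ i, τ ![u, e i] • e i;
      -(ω ![Aτ x, y, z] + ω ![x, Aτ y, z] + ω ![x, y, Aτ z]) = D 2 τ ![x, y, z] := by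
  intro τ x y z
  intro Aτ
  have hA : ∀ u b c : g, ω ![Aτ u, b, c] = ∑ i, τ ![u, e i] * ⟪e i, ⁅b, c⁆⟫_ℝ := by
    intro u b c
    rw [hω, hK]
    simp only [Aτ, map_sum, map_smul, LinearMap.sum_apply, LinearMap.smul_apply, smul_eq_mul,
      ← Finset.sum_neg_distrib]
    refine Finset.sum_congr rfl fun j _ => ?_
    rw [hK]; ring
  exact core_identity e (fun a b => ⁅a, b⁆) ω D hD1 (fun p q α β _ _ => hDanti p q α β) τ x y z Aτ hA
end
end

section
/- Let 𝔤 be a compact simple Lie algebra and Θ : Λ³(𝔤) → 𝔤 ⊗ 𝔤⊥, Θ(T) = Σ_i e_i ⊗ Π_{𝔤⊥}(e_i ⌟ T). Then ker Θ = ℝ·ω_𝔤, the line spanned by the Cartan 3-form. -/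
open scoped InnerProductSpace

noncomputable section

variable {g : Type*} [NormedAddCommGroup g] [InnerProductSpace ℝ g]

/-- The bracket (boundary) map `δ : Λ²𝔤 → 𝔤`, `v ∧ w ↦ [v,w]`, expressed through an
orthonormal basis. -/
def bdry [LieRing g] [LieAlgebra ℝ g] {ι : Type*} [Fintype ι]
    (e : OrthonormalBasis ι ℝ g) (τ : Form g 2) : g :=
  (2 : ℝ)⁻¹ • ∑ i, ∑ j, τ ![e i, e j] • ⁅e i, e j⁆


namespace KerTheta

variable {V : Type*} [NormedAddCommGroup V] [InnerProductSpace ℝ V]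

theorem innerF_two {ι : Type*} [Fintype ι] (e : OrthonormalBasis ι ℝ V) (α β : Form V 2) :
    innerF e 2 α β = (2 : ℝ)⁻¹ * ∑ i, ∑ j, α ![e i, e j] * β ![e i, e j] := by
  have hv : ∀ f : Fin 2 → ι, (fun i => e (f i)) = ![e (f 0), e (f 1)] := by
    intro f; ext i; fin_cases i <;> rfl
  unfold innerF
  rw [← Fintype.sum_prod_type' (f := fun i j => α ![e i, e j] * β ![e i, e j])]
  congr 1
  exact Fintype.sum_equiv (finTwoArrowEquiv ι) _ _ (fun f => by simp [hv])

theorem form2_ext_basis {ι : Type*} [Fintype ι] (e : OrthonormalBasis ι ℝ V) (α : Form V 2)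
    (h : ∀ i j, α ![e i, e j] = 0) : α = 0 := by
  refine e.toBasis.ext_alternating (fun v _ => ?_)
  have : (fun i => e.toBasis (v i)) = ![e (v 0), e (v 1)] := by
    ext i; fin_cases i <;> simp
  rw [this, h]; rfl

theorem innerF_self {ι : Type*} [Fintype ι] (e : OrthonormalBasis ι ℝ V) (α : Form V 2)
    (h : innerF e 2 α α = 0) : α = 0 := by
  rw [innerF_two] at h
  have h2 : ∑ i, ∑ j, α ![e i, e j] * α ![e i, e j] = 0 := by linarith
  apply form2_ext_basis e
  intro i j
  have hn : ∀ i ∈ Finset.univ, (0:ℝ) ≤ ∑ j, α ![e i, e j] * α ![e i, e j] :=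
    fun i _ => Finset.sum_nonneg (fun j _ => mul_self_nonneg _)
  have h3 := (Finset.sum_eq_zero_iff_of_nonneg hn).1 h2 i (Finset.mem_univ _)
  have h4 := (Finset.sum_eq_zero_iff_of_nonneg (fun j _ => mul_self_nonneg _)).1 h3 j
    (Finset.mem_univ _)
  exact mul_self_eq_zero.1 h4

theorem ctr_apply (x y z : V) (T : Form V 3) : ctr x T ![y, z] = T ![x, y, z] := rfl

theorem innerF_sub_left {ι : Type*} [Fintype ι] (e : OrthonormalBasis ι ℝ V)
    (α β γ : Form V 2) : innerF e 2 (α - β) γ = innerF e 2 α γ - innerF e 2 β γ := by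
  simp only [innerF, AlternatingMap.sub_apply, sub_mul, Finset.sum_sub_distrib, mul_sub]

/-- The boundary map, as a linear map. -/
def bdL {ι : Type*} [Fintype ι] (e : OrthonormalBasis ι ℝ V) (B : V →ₗ[ℝ] V →ₗ[ℝ] V) :
    Form V 2 →ₗ[ℝ] V where
  toFun τ := (2 : ℝ)⁻¹ • ∑ i, ∑ j, τ ![e i, e j] • B (e i) (e j)
  map_add' a b := by
    simp only [AlternatingMap.add_apply, add_smul, Finset.sum_add_distrib, smul_add]
  map_smul' c a := by
    simp only [AlternatingMap.smul_apply, smul_eq_mul, mul_smul, ← Finset.smul_sum,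
      RingHom.id_apply]
    rw [smul_comm]

/-- Contraction, linear in the vector. -/
def ctrL (T : Form V 3) : V →ₗ[ℝ] Form V 2 where
  toFun x := ctr x T
  map_add' a b := by simp [ctr]
  map_smul' c a := by simp [ctr]

/-- The quasi-centroid of a simple Lie algebra with Casimir `-1` is the scalars. -/
theorem scalar_of_quasicentroid [FiniteDimensional ℝ V] [Nontrivial V]
    {ι : Type*} [Fintype ι] (e : OrthonormalBasis ι ℝ V)
    (B : V →ₗ[ℝ] V →ₗ[ℝ] V) (hskew : ∀ x y, B x y = - B y x)
    (hJ : ∀ x y z, B (B x y) z = B x (B y z) - B y (B x z))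
    (hinv : ∀ x y z, ⟪B x y, z⟫_ℝ = ⟪x, B y z⟫_ℝ)
    (hcas : ∀ x, ∑ i, B (e i) (B (e i) x) = -x)
    (hsimple : ∀ W : Submodule ℝ V, (∀ x, ∀ w ∈ W, B x w ∈ W) → W = ⊥ ∨ W = ⊤)
    (A : V →ₗ[ℝ] V) (hA : ∀ x y, B (A x) y = B x (A y)) :
    ∃ c : ℝ, ∀ x, A x = c • x := by
  have hinv2 : ∀ x y z, ⟪B x y, z⟫_ℝ = -⟪y, B x z⟫_ℝ := by
    intro x y z
    rw [hskew x y, inner_neg_left, hinv]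
  have hA' : ∀ x y, B x (A y) = A.adjoint (B x y) := by
    intro x y
    refine ext_inner_right ℝ (fun z => ?_)
    rw [LinearMap.adjoint_inner_left, ← hA, hinv2, hA, hinv2]
  have h1 : ∀ y, ∑ i, B (A (e i)) (B (e i) y) = - A.adjoint y := by
    intro y
    rw [← map_neg, ← hcas, map_sum]
    exact Finset.sum_congr rfl (fun i _ => by rw [hA, hA'])
  have h2 : ∀ y, ∑ i, B (e i) (B (A (e i)) y) = - A y := by
    intro y
    rw [← hcas]
    exact Finset.sum_congr rfl (fun i _ => by rw [hA])
  have h0 : ∀ x, B (A x) x = 0 := by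
    intro x
    have h := hskew (A x) x
    rw [← hA] at h
    have h2 : (2 : ℝ) • B (A x) x = 0 := by
      rw [two_smul]; exact eq_neg_iff_add_eq_zero.1 h
    exact (smul_eq_zero.1 h2).resolve_left two_ne_zero
  have hadj : ∀ y, A.adjoint y = A y := by
    intro y
    have h3 : ∑ i, B (B (A (e i)) (e i)) y = 0 :=
      Finset.sum_eq_zero (fun i _ => by simp [h0])
    simp only [hJ, Finset.sum_sub_distrib, h1, h2] at h3
    rw [sub_eq_zero] at h3
    exact neg_injective h3
  have hsym : A.IsSymmetric := by
    intro x y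
    rw [← LinearMap.adjoint_inner_right, hadj]
  have hev := hsym.hasEigenvalue_iSup_of_finiteDimensional
  set c : ℝ := _ with hc
  change Module.End.HasEigenvalue A c at hev
  refine ⟨c, ?_⟩
  rcases hsimple (Module.End.eigenspace A c) (by
    intro x w hw
    rw [Module.End.mem_eigenspace_iff] at hw ⊢
    rw [← hadj, ← hA', hw, map_smul]) with h | h
  · exact absurd h hev
  · intro x
    rw [← Module.End.mem_eigenspace_iff, h]
    trivial

theorem core [FiniteDimensional ℝ V] [Nontrivial V]
    {ι : Type*} [Fintype ι] (e : OrthonormalBasis ι ℝ V)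
    (B : V →ₗ[ℝ] V →ₗ[ℝ] V) (hskew : ∀ x y, B x y = - B y x)
    (hJ : ∀ x y z, B (B x y) z = B x (B y z) - B y (B x z))
    (hinv : ∀ x y z, ⟪B x y, z⟫_ℝ = ⟪x, B y z⟫_ℝ)
    (hcas : ∀ x, ∑ i, B (e i) (B (e i) x) = -x)
    (hsimple : ∀ W : Submodule ℝ V, (∀ x, ∀ w ∈ W, B x w ∈ W) → W = ⊥ ∨ W = ⊤)
    (ω : Form V 3) (hω : ∀ x y z : V, ω ![x, y, z] = ⟪x, B y z⟫_ℝ)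
    (P : Form V 2 →ₗ[ℝ] Form V 2)
    (hP1 : ∀ τ : Form V 2, bdL e B (P τ) = 0)
    (hP2 : ∀ τ ψ : Form V 2, bdL e B ψ = 0 → innerF e 2 (τ - P τ) ψ = 0) :
    {T : Form V 3 | ∀ i, P (ctr (e i) T) = 0} = {T : Form V 3 | ∃ c : ℝ, T = c • ω} := by
  have hda : ∀ a (ψ : Form V 2), innerF e 2 (ctr a ω) ψ = ⟪a, bdL e B ψ⟫_ℝ := by
    intro a ψ
    rw [innerF_two]
    simp only [bdL, LinearMap.coe_mk, AddHom.coe_mk, inner_smul_right, inner_sum, ctr_apply, hω]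
    simp only [mul_comm]
  have hbd : ∀ a, bdL e B (ctr a ω) = (2 : ℝ)⁻¹ • a := by
    intro a
    simp only [bdL, LinearMap.coe_mk, AddHom.coe_mk, ctr_apply, hω]
    congr 1
    have ha : a = ∑ i, -B (e i) (B (e i) a) := by
      rw [Finset.sum_neg_distrib, hcas, neg_neg]
    refine Eq.trans (Finset.sum_congr rfl (fun i _ => ?_)) ha.symm
    have h2 : B a (e i) = - B (e i) a := hskew _ _
    have h3 := congrArg (B (e i)) (e.sum_repr' (B a (e i)))
    rw [map_sum, h2, map_neg] at h3
    rw [← h3]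
    refine Finset.sum_congr rfl (fun j _ => ?_)
    rw [← hinv, h2, real_inner_comm, map_smul]
  ext T
  constructor
  · intro hT
    change ∀ i, P (ctr (e i) T) = 0 at hT
    have hx : ∀ x, P (ctr x T) = 0 := by
      intro x
      have : P ∘ₗ ctrL T = 0 := e.toBasis.ext (fun i => by
        rw [OrthonormalBasis.coe_toBasis]; exact hT i)
      exact LinearMap.congr_fun this x
    let A : V →ₗ[ℝ] V := (2 : ℝ) • (bdL e B ∘ₗ ctrL T)
    have hAx : ∀ x, A x = (2 : ℝ) • bdL e B (ctr x T) := fun x => rfl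
    have hTA : ∀ x, ctr x T = ctr (A x) ω := by
      intro x
      rw [← sub_eq_zero]
      have hb : bdL e B (ctr x T - ctr (A x) ω) = 0 := by
        rw [map_sub, hbd, hAx, smul_smul]; norm_num
      apply innerF_self e
      have h1 := hP2 (ctr x T) _ hb
      rw [hx, sub_zero] at h1
      rw [innerF_sub_left, h1, hda, hb, inner_zero_right, sub_zero]
    have hTA' : ∀ x y z, T ![x, y, z] = ⟪A x, B y z⟫_ℝ := by
      intro x y z
      rw [← ctr_apply, hTA, ctr_apply, hω]
    have hTs : ∀ x y z, T ![x, y, z] = - T ![y, x, z] := by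
      intro x y z
      have := T.map_swap ![y, x, z] (i := 0) (j := 1) (by decide)
      rw [← this]
      congr 1
      ext i; fin_cases i <;> rfl
    have hA : ∀ x y, B (A x) y = B x (A y) := by
      intro x y
      refine ext_inner_right ℝ (fun z => ?_)
      rw [hinv, ← hTA', hTs, hTA', ← hinv, hskew x, inner_neg_left]
    obtain ⟨c, hc⟩ := scalar_of_quasicentroid e B hskew hJ hinv hcas hsimple A hA
    refine ⟨c, ?_⟩
    ext v
    have hv : v = ![v 0, v 1, v 2] := by ext i; fin_cases i <;> rfl
    rw [hv, AlternatingMap.smul_apply, hTA', hω, hc, real_inner_smul_left, smul_eq_mul]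
  · rintro ⟨c, rfl⟩ i
    have hw : P (ctr (e i) ω) = 0 := by
      apply innerF_self e
      have h1 := hP2 (ctr (e i) ω) _ (hP1 (ctr (e i) ω))
      rw [innerF_sub_left, hda, hP1, inner_zero_right] at h1
      linarith
    have : ctr (e i) (c • ω) = c • ctr (e i) ω := rfl
    rw [this, map_smul, hw, smul_zero]

theorem mid {L : Type*} [LieRing L] [LieAlgebra ℝ L] [LieAlgebra.IsSimple ℝ L]
    [FiniteDimensional ℝ V]
    (f : V ≃ L) (hK : ∀ x y : V, ⟪x, y⟫_ℝ = - killingForm ℝ L (f x) (f y))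
    {ι : Type*} [Fintype ι] (e : OrthonormalBasis ι ℝ V)
    (ω : Form V 3) (hω : ∀ x y z : V, ω ![x, y, z] = ⟪x, f.symm ⁅f y, f z⁆⟫_ℝ)
    (bd : Form V 2 → L)
    (hbd : ∀ τ, bd τ = (2 : ℝ)⁻¹ • ∑ i, ∑ j, τ ![e i, e j] • ⁅f (e i), f (e j)⁆)
    (P : Form V 2 →ₗ[ℝ] Form V 2)
    (hP1 : ∀ τ : Form V 2, bd (P τ) = 0)
    (hP2 : ∀ τ ψ : Form V 2, bd ψ = 0 → innerF e 2 (τ - P τ) ψ = 0) :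
    {T : Form V 3 | ∀ i, P (ctr (e i) T) = 0} = {T : Form V 3 | ∃ c : ℝ, T = c • ω} := by
  classical
  have hadd : ∀ x y, f (x + y) = f x + f y := by
    intro x y
    rw [← Equiv.apply_symm_apply f (f x + f y)]
    congr 1
    refine ext_inner_right ℝ (fun z => ?_)
    rw [inner_add_left, hK, hK, hK, Equiv.apply_symm_apply, map_add, LinearMap.add_apply]
    ring
  have hsmul : ∀ (c : ℝ) x, f (c • x) = c • f x := by
    intro c x
    rw [← Equiv.apply_symm_apply f (c • f x)]
    congr 1
    refine ext_inner_right ℝ (fun z => ?_)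
    rw [real_inner_smul_left, hK, hK, Equiv.apply_symm_apply, map_smul, LinearMap.smul_apply,
      smul_eq_mul]
    ring
  let F : V ≃ₗ[ℝ] L := { f with map_add' := hadd, map_smul' := hsmul }
  have hF : ∀ x, f x = F x := fun _ => rfl
  have hFs : ∀ x, f.symm x = F.symm x := fun _ => rfl
  simp only [hF, hFs] at hK hω hbd
  let B : V →ₗ[ℝ] V →ₗ[ℝ] V := LinearMap.mk₂ ℝ (fun x y => F.symm ⁅F x, F y⁆)
    (by intros; simp) (by intros; simp) (by intros; simp) (by intros; simp)
  have hB : ∀ x y, B x y = F.symm ⁅F x, F y⁆ := fun _ _ => rfl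
  have hinv : ∀ x y z, ⟪B x y, z⟫_ℝ = ⟪x, B y z⟫_ℝ := by
    intro x y z
    rw [hK, hK, hB, hB, F.apply_symm_apply, F.apply_symm_apply,
      killingForm, LieModule.traceForm_apply_lie_apply]
  have hskew : ∀ x y, B x y = - B y x := by
    intro x y
    rw [hB, hB, ← lie_skew, map_neg]
  have hbd' : ∀ τ, bd τ = F (bdL e B τ) := by
    intro τ
    simp [hbd, bdL, hB, map_sum]
  have hcas : ∀ x, ∑ i, B (e i) (B (e i) x) = -x := by
    intro x
    refine ext_inner_right ℝ (fun y => ?_)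
    rw [inner_neg_left, hK x y, neg_neg, killingForm, LieModule.traceForm_apply_apply,
      LinearMap.trace_eq_matrix_trace ℝ (e.toBasis.map F), Matrix.trace, sum_inner]
    refine Finset.sum_congr rfl (fun i _ => ?_)
    rw [Matrix.diag_apply, LinearMap.toMatrix_apply]
    have : ((e.toBasis.map F).repr ((LieModule.toEnd ℝ L L (F x) ∘ₗ LieModule.toEnd ℝ L L (F y))
        ((e.toBasis.map F) i))) i = ⟪e i, B x (B y (e i))⟫_ℝ := by
      simp [hB, OrthonormalBasis.repr_apply_apply]
    rw [this, hskew y, map_neg, inner_neg_right, ← hinv, hskew (e i) (B (e i) x),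
      inner_neg_left, hinv]
  have : Nontrivial V := by
    by_contra hn
    rw [not_nontrivial_iff_subsingleton] at hn
    have : Subsingleton L := F.symm.toEquiv.subsingleton
    exact LieAlgebra.IsSimple.non_abelian ℝ (L := L) ⟨fun x y => Subsingleton.elim _ _⟩
  refine core e B hskew ?_ hinv hcas ?_ ω hω P ?_ ?_
  · intro x y z
    simp only [hB, F.apply_symm_apply, ← map_sub]
    rw [lie_lie]
  · intro W hW
    let I : LieIdeal ℝ L :=
      { W.map F.toLinearMap with
        lie_mem := by
          rintro x m ⟨w, hw, rfl⟩
          refine ⟨B (F.symm x) w, hW _ _ hw, ?_⟩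
          simp [hB] }
    have hI : ∀ w, w ∈ W ↔ F w ∈ I := by
      intro w
      constructor
      · intro h; exact ⟨w, h, rfl⟩
      · rintro ⟨w', h, h'⟩
        have : w' = w := F.injective h'
        exact this ▸ h
    rcases LieAlgebra.IsSimple.eq_bot_or_eq_top (R := ℝ) I with h | h
    · left
      ext w
      rw [hI, h]; simp
    · right
      ext w
      rw [hI, h]; simp
  · intro τ
    have := hP1 τ
    rw [hbd'] at this
    simpa using this
  · intro τ ψ h
    apply hP2
    rw [hbd', h, map_zero]

end KerTheta

/-- Let `𝔤` be a compact *simple* Lie algebra and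
`Θ : Λ³(𝔤) → 𝔤 ⊗ 𝔤⊥`, `Θ(T) = Σ_i e_i ⊗ Π_{𝔤⊥}(e_i ⌟ T)`.  Then `ker Θ = ℝ·ω_𝔤`,
the line spanned by the Cartan 3-form: since `(e_i)` is a basis, `Θ(T) = 0` iff
`Π_{𝔤⊥}(e_i ⌟ T) = 0` for all `i`. -/
theorem ker_Theta_eq_span_cartan_form
    {g : Type*} [NormedAddCommGroup g] [InnerProductSpace ℝ g] [FiniteDimensional ℝ g]
    [LieRing g] [LieAlgebra ℝ g] [LieAlgebra.IsSimple ℝ g]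
    (hK : ∀ x y : g, ⟪x, y⟫_ℝ = - killingForm ℝ g x y)
    {ι : Type*} [Fintype ι] (e : OrthonormalBasis ι ℝ g)
    (ω : Form g 3) (hω : ∀ x y z : g, ω ![x, y, z] = ⟪x, ⁅y, z⁆⟫_ℝ)
    (P : Form g 2 →ₗ[ℝ] Form g 2)
    (hP1 : ∀ τ : Form g 2, bdry e (P τ) = 0)
    (hP2 : ∀ τ ψ : Form g 2, bdry e ψ = 0 → innerF e 2 (τ - P τ) ψ = 0) :
    {T : Form g 3 | ∀ i, P (ctr (e i) T) = 0} = {T : Form g 3 | ∃ c : ℝ, T = c • ω} := by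
  exact KerTheta.mid (V := g) (L := g) (Equiv.refl g) hK e ω hω (fun τ => bdry e τ) (fun τ => rfl) P hP1 hP2
end
end
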